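/- arXiv:2510.07935 — 13 statements merged into one kernel-verified Lean document; each statement's English description precedes it below -/
import Mathlib

section
/- For all real numbers p, q with 0 < p ≤ q < 1, kl(p‖q) ≥ (q − p)² / (2q(1 − p)). -/
/-- KL divergence between Bernoulli distributions with means `p` and `q`. -/
noncomputable def klBer (p q : ℝ) : ℝ :=
  p * Real.log (p / q) + (1 - p) * Real.log ((1 - p) / (1 - q))

/-- For all real `p, q` with `0 < p ≤ q < 1`,
`kl(p‖q) ≥ (q − p)² / (2q(1 − p))`. -/
theorem klBer_ge_trp (p q : ℝ) (hp : 0 < p) (hpq : p ≤ q) (hq : q < 1) :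
    klBer p q ≥ (q - p) ^ 2 / (2 * q * (1 - p)) := by
  have hq0 : 0 < q := by linarith
  have hp1 : 0 < 1 - p := by linarith
  have hq1 : 0 < 1 - q := by linarith
  have h1 : Real.log (q / p) ≤ (q / p - p / q) / 2 := by
    have h := Real.self_le_sinh_iff.2 (Real.log_nonneg ((one_le_div hp).2 hpq))
    rw [Real.sinh_log (by positivity), inv_div] at h
    exact h
  have h2 : (q - p) / (1 - p) + ((q - p) / (1 - p)) ^ 2 / 2
      ≤ Real.log ((1 - p) / (1 - q)) := by
    set t := (q - p) / (1 - p) with ht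
    have ht0 : 0 ≤ t := div_nonneg (by linarith) hp1.le
    have ht1 : t < 1 := by rw [ht, div_lt_one hp1]; linarith
    have hs := Real.hasSum_pow_div_log_of_abs_lt_one (x := t) (by rwa [abs_of_nonneg ht0])
    have h := sum_le_hasSum (Finset.range 2) (fun i _ => by positivity) hs
    have e : (1 - p) / (1 - q) = (1 - t)⁻¹ := by
      rw [ht, one_sub_div hp1.ne', inv_div]; congr 1; ring
    rw [e, Real.log_inv]
    norm_num [Finset.sum_range_succ] at h
    linarith
  have e1 : Real.log (p / q) = - Real.log (q / p) := by
    rw [← Real.log_inv, inv_div]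
  have h3 := mul_le_mul_of_nonneg_left h1 hp.le
  have h4 := mul_le_mul_of_nonneg_left h2 hp1.le
  have h5 : (q - p) ^ 2 / (2 * q * (1 - p)) + (q - p) ^ 3 / (2 * q * (1 - p))
      = - (p * ((q / p - p / q) / 2)) +
        (1 - p) * ((q - p) / (1 - p) + ((q - p) / (1 - p)) ^ 2 / 2) := by
    field_simp
    ring
  have h6 : 0 ≤ (q - p) ^ 3 / (2 * q * (1 - p)) :=
    div_nonneg (pow_nonneg (by linarith) 3) (by positivity)
  unfold klBer
  rw [e1]
  linarith
end

section
/- For all real numbers p, q with 0 < p ≤ q < 1, kl(p‖q) ≥ q − √(2qp − p²). -/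
/-- For all real `p, q` with `0 < p ≤ q < 1`, `kl(p‖q) ≥ q − √(2qp − p²)`. -/
theorem klBer_ge_rts (p q : ℝ) (hp : 0 < p) (hpq : p ≤ q) (hq : q < 1) :
    klBer p q ≥ q - Real.sqrt (2 * q * p - p ^ 2) := by
  have hq0 : 0 < q := lt_of_lt_of_le hp hpq
  have h1p : 0 < 1 - p := by linarith
  have h1q : 0 < 1 - q := by linarith
  have ht0 : 0 ≤ Real.log (q / p) := Real.log_nonneg ((one_le_div hp).2 hpq)
  have hexp := Real.quadratic_le_exp_of_nonneg ht0
  rw [Real.exp_log (div_pos hq0 hp)] at hexp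
  have hneg : Real.log (p / q) = - Real.log (q / p) := by
    rw [← Real.log_inv, inv_div]
  have hB : q - p ≤ (1 - p) * Real.log ((1 - p) / (1 - q)) := by
    have h := Real.one_sub_inv_le_log_of_pos (div_pos h1p h1q)
    have h2 := mul_le_mul_of_nonneg_left h h1p.le
    have h3 : (1 - p) * (1 - ((1 - p) / (1 - q))⁻¹) = q - p := by
      field_simp
      ring
    linarith
  unfold klBer
  rw [hneg]
  set t := Real.log (q / p)
  have hS : p * (1 + t) ≤ Real.sqrt (2 * q * p - p ^ 2) := by
    apply Real.le_sqrt_of_sq_le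
    have h4 : q = p * (q / p) := by field_simp
    have h5 := mul_le_mul_of_nonneg_left hexp (sq_nonneg p)
    have h6 : p ^ 2 * (q / p) = q * p := by field_simp
    nlinarith
  linarith
end

section
/- For every real p with 0 < p < 1 and every Δ with 0 ≤ Δ < 1 − p, the following inequality holds: (1−p)/(1−p−Δ) − p/(p+Δ) − Δ/((1−p)(p+Δ)) + Δ²/(2(1−p)(p+Δ)²) ≥ 0. -/
/-- Nonnegativity of the derivative in `Δ` of
`g_p(Δ) := kl(p‖p+Δ) − Δ²/(2(p+Δ)(1−p))`. -/
theorem trp_deriv_nonneg (p Δ : ℝ) (hp0 : 0 < p) (hp1 : p < 1)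
    (hΔ0 : 0 ≤ Δ) (hΔ1 : Δ < 1 - p) :
    (1 - p) / (1 - p - Δ) - p / (p + Δ) - Δ / ((1 - p) * (p + Δ))
      + Δ ^ 2 / (2 * (1 - p) * (p + Δ) ^ 2) ≥ 0 := by
  have h1 : 0 < 1 - p := by linarith
  have h2 : 0 < 1 - p - Δ := by linarith
  have h3 : 0 < p + Δ := by linarith
  have key : (1 - p) / (1 - p - Δ) - p / (p + Δ) - Δ / ((1 - p) * (p + Δ))
      = Δ ^ 2 / ((1 - p - Δ) * (1 - p) * (p + Δ)) := by
    have := h1.ne'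
    have := h2.ne'
    have := h3.ne'
    field_simp
    ring
  rw [key]
  positivity
end

section
/- For every real p with 0 < p < 1 and every Δ with 0 ≤ Δ < 1 − p, the following inequality holds: (1−p)/(1−p−Δ) − p/(p+Δ) + p/√(p² + 2pΔ) − 1 ≥ 0. -/
/-- Nonnegativity of the derivative in `Δ` of
`g_p(Δ) := kl(p‖p+Δ) − ((p+Δ) − √(2(p+Δ)p − p²))`. -/
theorem rts_deriv_nonneg (p Δ : ℝ) (hp0 : 0 < p) (hp1 : p < 1)
    (hΔ0 : 0 ≤ Δ) (hΔ1 : Δ < 1 - p) :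
    (1 - p) / (1 - p - Δ) - p / (p + Δ) + p / Real.sqrt (p ^ 2 + 2 * p * Δ) - 1 ≥ 0 := by
  have hpos : 0 < Real.sqrt (p ^ 2 + 2 * p * Δ) := Real.sqrt_pos.mpr (by positivity)
  have hle : Real.sqrt (p ^ 2 + 2 * p * Δ) ≤ p + Δ :=
    Real.sqrt_le_iff.mpr ⟨by linarith, by nlinarith [sq_nonneg Δ]⟩
  have h1 : p / (p + Δ) ≤ p / Real.sqrt (p ^ 2 + 2 * p * Δ) :=
    div_le_div_of_nonneg_left hp0.le hpos hle
  have h2 : 1 ≤ (1 - p) / (1 - p - Δ) := by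
    rw [le_div_iff₀ (by linarith)]
    linarith
  linarith
end

section
/- For all real numbers p, q, K with 0 < p ≤ q < 1 and K ≥ 0, if kl(p‖q) ≤ K then q ≤ (√(p + K(1−p)/2) + √(K(1−p)/2))². -/
theorem trp_aux (p q : ℝ) (hp : 0 < p) (hpq : p ≤ q) (hq : q < 1) :
    (q - p) ^ 2 ≤ 2 * q * (1 - p) * klBer p q := by
  have h1p : 0 < 1 - p := by linarith
  let f : ℝ → ℝ := fun t => p * (Real.log p - Real.log t)
    + (1 - p) * (Real.log (1 - p) - Real.log (1 - t))
    - (t - 2 * p + p ^ 2 * t⁻¹) / (2 * (1 - p))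
  have hd : ∀ t ∈ Set.Icc p q, HasDerivAt f (p * (0 - t⁻¹) + (1 - p) * (0 - (-1) / (1 - t))
      - (1 - 0 + p ^ 2 * (-(t ^ 2)⁻¹)) / (2 * (1 - p))) t := by
    intro t ht
    have ht0 : t ≠ 0 := by linarith [ht.1]
    have ht1 : 1 - t ≠ 0 := by linarith [ht.2]
    have e1 := ((hasDerivAt_const t (Real.log p)).sub (Real.hasDerivAt_log ht0)).const_mul p
    have e2 := ((hasDerivAt_const t (Real.log (1 - p))).sub
      (((hasDerivAt_id t).const_sub 1).log ht1)).const_mul (1 - p)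
    have e3 := ((((hasDerivAt_id t).sub (hasDerivAt_const t (2 * p))).add
      ((hasDerivAt_inv ht0).const_mul (p ^ 2))).div_const (2 * (1 - p)))
    exact (e1.add e2).sub e3
  have hm : MonotoneOn f (Set.Icc p q) := by
    apply monotoneOn_of_deriv_nonneg (convex_Icc p q)
    · exact fun t ht => (hd t ht).continuousAt.continuousWithinAt
    · exact fun t ht => (hd t (interior_subset ht)).differentiableAt.differentiableWithinAt
    · intro t ht
      have ht := interior_subset ht
      rw [(hd t ht).deriv]
      have a1 : 0 < t := by linarith [ht.1]
      have a2 : 0 < 1 - t := by linarith [ht.2]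
      have a3 : 0 ≤ t - p := by linarith [ht.1]
      have : p * (0 - t⁻¹) + (1 - p) * (0 - (-1) / (1 - t))
        - (1 - 0 + p ^ 2 * (-(t ^ 2)⁻¹)) / (2 * (1 - p))
        = (t - p) * ((t - p) * (1 - p) + (t + p) * (t - p)) / (2 * t ^ 2 * (1 - t) * (1 - p)) := by
        field_simp
        ring
      rw [this]
      positivity
  have key := hm (Set.left_mem_Icc.2 hpq) (Set.right_mem_Icc.2 hpq) hpq
  have q0 : 0 < q := by linarith
  have q1 : 0 < 1 - q := by linarith
  have fp : f p = 0 := by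
    simp only [f]
    field_simp
    ring
  have fq : f q = klBer p q - (q - p) ^ 2 / (2 * q * (1 - p)) := by
    simp only [f, klBer]
    rw [Real.log_div hp.ne' q0.ne', Real.log_div h1p.ne' q1.ne']
    field_simp
    ring
  rw [fp, fq, sub_nonneg, div_le_iff₀ (by positivity)] at key
  linarith

/-- Tighter Refined Pinsker (TRP) explicit bound: for `0 < p ≤ q < 1` and `K ≥ 0`,
if `kl(p‖q) ≤ K` then `q ≤ (√(p + K(1−p)/2) + √(K(1−p)/2))²`. -/
theorem trp_bound (p q K : ℝ) (hp : 0 < p) (hpq : p ≤ q) (hq : q < 1) (hK : 0 ≤ K)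
    (h : klBer p q ≤ K) :
    q ≤ (Real.sqrt (p + K * (1 - p) / 2) + Real.sqrt (K * (1 - p) / 2)) ^ 2 := by
  have h1p : 0 < 1 - p := by linarith
  have q0 : 0 < q := by linarith
  have h1 := trp_aux p q hp hpq hq
  have h2 : 2 * q * (1 - p) * klBer p q ≤ 2 * q * (1 - p) * K := by gcongr
  have ha : 0 ≤ K * (1 - p) / 2 := by positivity
  have h3 : (q - p) ^ 2 ≤ 4 * (K * (1 - p) / 2) * q := by linarith
  generalize K * (1 - p) / 2 = a at *
  have sa := Real.sq_sqrt ha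
  have sq := Real.sq_sqrt q0.le
  have h4 : q - p ≤ 2 * √a * √q := by
    refine le_of_abs_le (abs_le_of_sq_le_sq ?_ (by positivity))
    rw [mul_pow, mul_pow, sa, sq]; linarith
  have h5 : √q - √a ≤ √(p + a) := by
    apply Real.le_sqrt_of_sq_le
    nlinarith
  calc q = √q ^ 2 := sq.symm
    _ ≤ _ := by gcongr; linarith
end

section
/- For all real numbers p, q, K with 0 < p ≤ q < 1 and K ≥ 0, if kl(p‖q) ≤ K then q ≤ p + K + √(2pK). -/
/-- Refined Tolstikhin–Seldin (RTS) explicit bound: for `0 < p ≤ q < 1` and `K ≥ 0`,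
if `kl(p‖q) ≤ K` then `q ≤ p + K + √(2pK)`. -/
theorem rts_bound (p q K : ℝ) (hp : 0 < p) (hpq : p ≤ q) (hq : q < 1) (hK : 0 ≤ K)
    (h : klBer p q ≤ K) :
    q ≤ p + K + Real.sqrt (2 * p * K) := by
  have hq0 : 0 < q := lt_of_lt_of_le hp hpq
  have hx : 1 ≤ q / p := by rwa [le_div_iff₀ hp, one_mul]
  obtain ⟨u, hu0, hu⟩ : ∃ u : ℝ, 0 ≤ u ∧ q / p = 1 + u + u ^ 2 / 2 := by
    refine ⟨Real.sqrt (2 * (q / p) - 1) - 1, ?_, ?_⟩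
    · have : 1 ≤ Real.sqrt (2 * (q / p) - 1) := Real.one_le_sqrt.mpr (by linarith)
      linarith
    · have := Real.sq_sqrt (show 0 ≤ 2 * (q / p) - 1 by linarith)
      nlinarith
  have hlog : Real.log (q / p) ≤ u := by
    rw [Real.log_le_iff_le_exp (by linarith), hu]
    exact Real.quadratic_le_exp_of_nonneg hu0
  have hlog1 : Real.log (p / q) = - Real.log (q / p) := by
    rw [← Real.log_inv, inv_div]
  have h1p : 0 < 1 - p := by linarith
  have h1q : 0 < 1 - q := by linarith
  have hlog2 : q - p ≤ (1 - p) * Real.log ((1 - p) / (1 - q)) := by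
    have h1 := Real.one_sub_inv_le_log_of_pos (div_pos h1p h1q)
    rw [inv_div] at h1
    have h2 := mul_le_mul_of_nonneg_left h1 h1p.le
    have h3 : (1 - p) * (1 - (1 - q) / (1 - p)) = q - p := by
      field_simp
      ring
    linarith
  have hqe : q = p * (1 + u + u ^ 2 / 2) := by
    rw [← hu]
    field_simp
  unfold klBer at h
  rw [hlog1] at h
  have h4 := mul_le_mul_of_nonneg_left hlog hp.le
  have hA : q - p - p * u ≤ K := by linarith
  have hB : p * u ≤ Real.sqrt (2 * p * K) := by
    apply Real.le_sqrt_of_sq_le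
    have : p * u ^ 2 / 2 ≤ K := by nlinarith
    nlinarith
  linarith
end

section
/- For all real numbers p, q, k with 0 < p ≤ q and k ≥ 0, one has q − √(2qp − p²) ≤ k if and only if q ≤ p + k + √(2pk). -/
/-- For `0 < p ≤ q` and `k ≥ 0`:
`q − √(2qp − p²) ≤ k ↔ q ≤ p + k + √(2pk)`. -/
theorem rts_equiv (p q k : ℝ) (hp : 0 < p) (hpq : p ≤ q) (hk : 0 ≤ k) :
    q - Real.sqrt (2 * q * p - p ^ 2) ≤ k ↔ q ≤ p + k + Real.sqrt (2 * p * k) := by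
  constructor
  · intro h
    rcases le_or_gt (q - k) 0 with hd | hd
    · have := Real.sqrt_nonneg (2 * p * k)
      linarith
    · have h1 : q - k ≤ Real.sqrt (2 * q * p - p ^ 2) := by linarith
      have h2 := (Real.le_sqrt' hd).1 h1
      have h3 : (q - k - p) ^ 2 ≤ 2 * p * k := by nlinarith
      have h4 := (le_abs_self _).trans (Real.abs_le_sqrt h3)
      linarith
  · intro h
    have key : q - k ≤ p ∨ p < q - k := le_or_gt _ _
    rcases key with hd | hd
    · have h3 : p ^ 2 ≤ 2 * q * p - p ^ 2 := by nlinarith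
      have h4 := (le_abs_self _).trans (Real.abs_le_sqrt h3)
      linarith
    · have h1 : q - k - p ≤ Real.sqrt (2 * p * k) := by linarith
      have h2 := (Real.le_sqrt' (by linarith)).1 h1
      have h3 : (q - k) ^ 2 ≤ 2 * q * p - p ^ 2 := by nlinarith
      have h4 := (le_abs_self _).trans (Real.abs_le_sqrt h3)
      linarith
end

section
/- For all real numbers p, q, k with 0 < p ≤ q < 1 and k ≥ 0, one has (q − p)²/(2q(1 − p)) ≤ k if and only if q ≤ (√(p + k(1−p)/2) + √(k(1−p)/2))². -/
/-- For `0 < p ≤ q < 1` and `k ≥ 0`: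
`(q − p)²/(2q(1 − p)) ≤ k ↔ q ≤ (√(p + k(1−p)/2) + √(k(1−p)/2))²`. -/
theorem trp_equiv (p q k : ℝ) (hp : 0 < p) (hpq : p ≤ q) (hq : q < 1) (hk : 0 ≤ k) :
    (q - p) ^ 2 / (2 * q * (1 - p)) ≤ k ↔
      q ≤ (Real.sqrt (p + k * (1 - p) / 2) + Real.sqrt (k * (1 - p) / 2)) ^ 2 := by
  have hq0 : 0 < q := lt_of_lt_of_le hp hpq
  have h1 : 0 < 1 - p := by linarith
  have hc : 0 ≤ k * (1 - p) / 2 := by positivity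
  have hb2 := Real.sq_sqrt hc
  have ha2 := Real.sq_sqrt (show 0 ≤ p + k * (1 - p) / 2 by positivity)
  have hs2 := Real.sq_sqrt hq0.le
  have hb := Real.sqrt_nonneg (k * (1 - p) / 2)
  have ha := Real.sqrt_nonneg (p + k * (1 - p) / 2)
  have hs := Real.sqrt_nonneg q
  have hab : Real.sqrt (k * (1 - p) / 2) ≤ Real.sqrt (p + k * (1 - p) / 2) :=
    Real.sqrt_le_sqrt (by linarith)
  rw [div_le_iff₀ (by positivity)]
  generalize Real.sqrt (k * (1 - p) / 2) = b at *
  generalize Real.sqrt (p + k * (1 - p) / 2) = a at *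
  generalize Real.sqrt q = s at *
  have e1 : k * (2 * q * (1 - p)) = (2 * s * b) ^ 2 := by
    rw [mul_pow, mul_pow, hs2, hb2]; ring
  have e2 : q - p ≤ 2 * s * b ↔ (s - b) ^ 2 ≤ a ^ 2 := by
    constructor <;> intro h <;> nlinarith
  rw [e1, pow_le_pow_iff_left₀ (by linarith) (by positivity) two_ne_zero, e2, ← hs2,
    pow_le_pow_iff_left₀ hs (by positivity) two_ne_zero, sq_le_sq, abs_of_nonneg ha, abs_le]
  constructor
  · intro h; linarith [h.2]
  · intro h; constructor <;> linarith
end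

section
/- For all real numbers p, q, k with 0 < p ≤ q and k ≥ 0, one has (2q − p − √(4qp − 3p²))/4 ≤ k if and only if q ≤ p + 2k + √(2pk). -/
/-- For `0 < p ≤ q` and `k ≥ 0`:
`(2q − p − √(4qp − 3p²))/4 ≤ k ↔ q ≤ p + 2k + √(2pk)`. -/
theorem ts_equiv (p q k : ℝ) (hp : 0 < p) (hpq : p ≤ q) (hk : 0 ≤ k) :
    (2 * q - p - Real.sqrt (4 * q * p - 3 * p ^ 2)) / 4 ≤ k ↔
      q ≤ p + 2 * k + Real.sqrt (2 * p * k) := by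
  have hs2 : Real.sqrt (4 * q * p - 3 * p ^ 2) ^ 2 = 4 * q * p - 3 * p ^ 2 :=
    Real.sq_sqrt (by nlinarith)
  have ht2 : Real.sqrt (2 * p * k) ^ 2 = 2 * p * k := Real.sq_sqrt (by positivity)
  have hsp : p ≤ Real.sqrt (4 * q * p - 3 * p ^ 2) := Real.le_sqrt_of_sq_le (by nlinarith)
  have ht : 0 ≤ Real.sqrt (2 * p * k) := Real.sqrt_nonneg _
  generalize Real.sqrt (4 * q * p - 3 * p ^ 2) = s at *
  generalize Real.sqrt (2 * p * k) = t at *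
  have h1 : (2 * q - p - s) / 4 ≤ k ↔ s - p ≤ 2 * t := by
    rw [← pow_le_pow_iff_left₀ (by linarith : 0 ≤ s - p) (by linarith : 0 ≤ 2 * t) two_ne_zero,
      ← mul_le_mul_iff_right₀ (by linarith : 0 < 8 * p)]
    constructor <;> intro h <;> nlinarith
  have h2 : q ≤ p + 2 * k + t ↔ s ≤ p + 2 * t := by
    rw [← pow_le_pow_iff_left₀ (by linarith : 0 ≤ s) (by linarith : 0 ≤ p + 2 * t) two_ne_zero,
      ← mul_le_mul_iff_right₀ (by linarith : 0 < 4 * p)]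
    constructor <;> intro h <;> nlinarith
  rw [h1, h2]
  constructor <;> intro h <;> linarith
end

section
/- For all real numbers p, k with 0 < p < 1 and k > 0, (√(p + k(1−p)/2) + √(k(1−p)/2))² < (√(p + k/2) + √(k/2))². -/
/-- The Tighter Refined Pinsker (TRP) explicit upper bound is strictly smaller than
the PAC-Bayes-quadratic (PBQ) upper bound for every `p ∈ (0,1)` and `k > 0`. -/
theorem trp_lt_pbq (p k : ℝ) (hp0 : 0 < p) (hp1 : p < 1) (hk : 0 < k) :
    (Real.sqrt (p + k * (1 - p) / 2) + Real.sqrt (k * (1 - p) / 2)) ^ 2 <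
      (Real.sqrt (p + k / 2) + Real.sqrt (k / 2)) ^ 2 := by
  have hkp : 0 < k * p := mul_pos hk hp0
  have hq : 0 ≤ k * (1 - p) := mul_nonneg hk.le (by linarith)
  have h1 : Real.sqrt (p + k * (1 - p) / 2) < Real.sqrt (p + k / 2) :=
    Real.sqrt_lt_sqrt (by linarith) (by linarith)
  have h2 : Real.sqrt (k * (1 - p) / 2) < Real.sqrt (k / 2) :=
    Real.sqrt_lt_sqrt (by linarith) (by linarith)
  exact pow_lt_pow_left₀ (add_lt_add h1 h2) (by positivity) two_ne_zero
end

section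
/- For all real numbers p, q with 0 < p ≤ q < 1, q − √(2qp − p²) ≥ (2q − p − √(4qp − 3p²))/4. -/
/-- For `0 < p ≤ q < 1`, the RTS lower bound on the Bernoulli KL divergence is
universally tighter than the TS lower bound:
`q − √(2qp − p²) ≥ (2q − p − √(4qp − 3p²))/4`. -/
theorem rts_ge_ts (p q : ℝ) (hp : 0 < p) (hpq : p ≤ q) (hq : q < 1) :
    q - Real.sqrt (2 * q * p - p ^ 2) ≥
      (2 * q - p - Real.sqrt (4 * q * p - 3 * p ^ 2)) / 4 := by
  have ha := Real.sqrt_nonneg (2 * q * p - p ^ 2)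
  have hb := Real.sqrt_nonneg (4 * q * p - 3 * p ^ 2)
  have ha2 := Real.sq_sqrt (show 0 ≤ 2 * q * p - p ^ 2 by nlinarith)
  have hb2 := Real.sq_sqrt (show 0 ≤ 4 * q * p - 3 * p ^ 2 by nlinarith)
  set a := Real.sqrt (2 * q * p - p ^ 2)
  set b := Real.sqrt (4 * q * p - 3 * p ^ 2)
  have hap : p ≤ a := by
    refine (abs_le_of_sq_le_sq' ?_ ha).2
    nlinarith
  have hpb : 0 ≤ p * b := by positivity
  have key : 4 * a * p - a ^ 2 - 2 * p ^ 2 ≤ p * b := by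
    rcases le_total a (5 * p) with h | h
    · refine (abs_le_of_sq_le_sq' ?_ hpb).2
      have h1 : 0 ≤ (a - p) ^ 3 * (5 * p - a) :=
        mul_nonneg (pow_nonneg (by linarith) 3) (by linarith)
      have h2 : (p * b) ^ 2 = p ^ 2 * (2 * a ^ 2 - p ^ 2) := by
        rw [mul_pow, hb2, ha2]; ring
      rw [h2]
      linarith [show p ^ 2 * (2 * a ^ 2 - p ^ 2) - (4 * a * p - a ^ 2 - 2 * p ^ 2) ^ 2
        = (a - p) ^ 3 * (5 * p - a) by ring]
    · nlinarith
  have h3 : 0 ≤ p * (2 * q + p + b - 4 * a) := by nlinarith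
  have h4 := nonneg_of_mul_nonneg_right h3 hp
  linarith
end

section
/- For all real numbers p, q with 0 < p ≤ q < 1, q − √(2qp − p²) ≥ (q − p)²/(2q). -/
/-- For `0 < p ≤ q < 1`, the RTS lower bound on the Bernoulli KL divergence is
universally tighter than the refined Pinsker lower bound:
`q − √(2qp − p²) ≥ (q − p)²/(2q)`. -/
theorem rts_ge_refined_pinsker (p q : ℝ) (hp : 0 < p) (hpq : p ≤ q) (hq : q < 1) :
    q - Real.sqrt (2 * q * p - p ^ 2) ≥ (q - p) ^ 2 / (2 * q) := by
  have hq0 : 0 < q := lt_of_lt_of_le hp hpq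
  have h0 : 0 ≤ 2 * q * p - p ^ 2 := by nlinarith
  have hs := Real.sq_sqrt h0
  rw [ge_iff_le, div_le_iff₀ (by positivity)]
  nlinarith [sq_nonneg (q - Real.sqrt (2 * q * p - p ^ 2))]
end

section
/- (PAC-Bayes-kl, Maurer) Let (Z, 𝒵) and (H, ℋ) be measurable spaces, μ a probability measure on Z, n ≥ 8 a natural number, δ ∈ (0,1), and l : H × Z → ℝ a measurable loss function with 0 ≤ l(h,z) ≤ 1 for all h, z. Let Q₀ be a probability measure on H, and let Q be a Markov kernel from Zⁿ to probability measures on H (the data-dependent posterior). For a probability measure ρ on H define the true risk L(ρ) := ∫_H ∫_Z l(h,z) dμ(z) dρ(h) and, for a sample S = (z₁,…,zₙ) ∈ Zⁿ, the empirical risk L̂_S(ρ) := ∫_H (1/n)·Σᵢ l(h,zᵢ) dρ(h). Then, with probability at least 1 − δ over S drawn from the n-fold product measure μ⊗ⁿ, it holds that kl(L̂_S(Q(S)) ‖ L(Q(S))) ≤ (KL(Q(S) ‖ Q₀) + log(2√n/δ)) / n. -/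
open MeasureTheory ProbabilityTheory Classical

/-- KL divergence between Bernoulli distributions with means `p` and `q`, valued in
the extended reals, with the conventions `0·log 0 = 0` and `p·log(p/0) = ∞` for
`p > 0`. -/
noncomputable def klBerE (p q : ℝ) : EReal :=
  (if p = 0 then (0 : EReal)
    else if q = 0 then ⊤ else ((p * Real.log (p / q) : ℝ) : EReal)) +
  (if p = 1 then (0 : EReal)
    else if q = 1 then ⊤ else (((1 - p) * Real.log ((1 - p) / (1 - q)) : ℝ) : EReal))

/-- Kullback–Leibler divergence `KL(ν‖μ)` between measures, valued in the extended
reals; it is `+∞` unless `ν ≪ μ` and the log-likelihood ratio is `ν`-integrable. -/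
noncomputable def measKL {H : Type*} [MeasurableSpace H] (ν μ : Measure H) : EReal :=
  if ν ≪ μ ∧ Integrable (fun h => Real.log (ν.rnDeriv μ h).toReal) ν
  then ((∫ h, Real.log (ν.rnDeriv μ h).toReal ∂ν : ℝ) : EReal)
  else ⊤


lemma arcsin_aux {y d : ℝ} (hy : 0 ≤ y) (hy1 : y < 1) (hd : 0 ≤ d) (h : y + d ≤ 1) :
    d / √(1 - y ^ 2) ≤ Real.arcsin (y + d) - Real.arcsin y := by
  have key := (convex_Icc y 1).mul_sub_le_image_sub_of_le_deriv (f := Real.arcsin)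
    (C := 1 / √(1 - y ^ 2)) Real.continuous_arcsin.continuousOn ?_ ?_ y ⟨le_rfl, hy1.le⟩ (y + d)
    ⟨by linarith, h⟩ (by linarith)
  · calc d / √(1 - y ^ 2) = 1 / √(1 - y ^ 2) * (y + d - y) := by ring
      _ ≤ _ := key
  · intro x hx
    rw [interior_Icc] at hx
    exact (Real.differentiableAt_arcsin.2 ⟨by linarith [hx.1], hx.2.ne⟩).differentiableWithinAt
  · intro x hx
    rw [interior_Icc] at hx
    rw [Real.deriv_arcsin]
    have : 0 < 1 - x ^ 2 := by nlinarith [hx.1, hx.2]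
    apply one_div_le_one_div_of_le (Real.sqrt_pos.2 this)
    apply Real.sqrt_le_sqrt
    nlinarith [hx.1, hx.2]

lemma arcsin_aux' {y d : ℝ} (hy : y ≤ 0) (hy1 : -1 < y) (hd : 0 ≤ d) (h : -1 ≤ y - d) :
    d / √(1 - y ^ 2) ≤ Real.arcsin y - Real.arcsin (y - d) := by
  have := arcsin_aux (y := -y) (d := d) (by linarith) (by linarith) hd (by linarith)
  have e : -y + d = -(y - d) := by ring
  rw [e, Real.arcsin_neg, Real.arcsin_neg, neg_sq] at this
  linarith

lemma sum_inv_sqrt (n : ℕ) (hn : 3 ≤ n) :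
    ∑ j ∈ Finset.range (n - 1), 1 / √(((j : ℝ) + 1) * (n - (j + 1))) ≤ Real.pi := by
  have hn0 : (0 : ℝ) < n := by positivity
  set G : ℝ → ℝ := fun x => Real.arcsin (2 * x / n - 1) with hG
  set a : ℕ → ℝ := fun k => if 2 * k ≤ n then G k else G (k + 1) with ha
  have hGm : Monotone G := by
    intro x y hxy
    apply Real.monotone_arcsin
    gcongr
  have hval : ∀ x : ℝ, √(1 - (2 * x / n - 1) ^ 2) = 2 / n * √(x * (n - x)) := by
    intro x
    have : 1 - (2 * x / n - 1) ^ 2 = (2 / n) ^ 2 * (x * (n - x)) := by field_simp; ring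
    rw [this, Real.sqrt_mul (by positivity), Real.sqrt_sq (by positivity)]
  have hdiv : ∀ x : ℝ, (2 / n : ℝ) / (2 / n * √(x * (n - x))) = 1 / √(x * (n - x)) := by
    intro x
    have : (2 / n : ℝ) ≠ 0 := by positivity
    rw [div_mul_eq_div_div, div_self this]
  have hterm : ∀ j ∈ Finset.range (n - 1),
      1 / √(((j : ℝ) + 1) * (n - (j + 1))) ≤ a (j + 1) - a j := by
    intro j hj
    rw [Finset.mem_range] at hj
    have hj' : (j : ℝ) + 1 + 1 ≤ n := by exact_mod_cast (by omega : j + 1 + 1 ≤ n)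
    by_cases h : 2 * (j + 1) ≤ n
    · have h' : 2 * ((j : ℝ) + 1) ≤ n := by exact_mod_cast h
      have := arcsin_aux' (y := 2 * ((j : ℝ) + 1) / n - 1) (d := 2 / n)
        (by rw [sub_nonpos, div_le_one hn0]; exact h')
        (by have : 0 < 2 * ((j : ℝ) + 1) / n := by positivity
            linarith) (by positivity)
        (by have : 0 ≤ 2 * (j : ℝ) / n := by positivity
            have e : 2 * ((j : ℝ) + 1) / n - 1 - 2 / n = 2 * (j : ℝ) / n - 1 := by ring
            rw [e]; linarith)
      rw [hval, hdiv] at this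
      have e : 2 * ((j : ℝ) + 1) / n - 1 - 2 / n = 2 * (j : ℝ) / n - 1 := by ring
      rw [e] at this
      have h2 : 2 * j ≤ n := by omega
      simp only [ha, h, h2, if_true, hG]
      push_cast
      exact this
    · have h' : (n : ℝ) ≤ 2 * ((j : ℝ) + 1) := by exact_mod_cast (by omega : n ≤ 2 * (j + 1))
      have e : 2 * ((j : ℝ) + 1) / n - 1 + 2 / n = 2 * ((j : ℝ) + 1 + 1) / n - 1 := by ring
      have := arcsin_aux (y := 2 * ((j : ℝ) + 1) / n - 1) (d := 2 / n)
        (by rw [sub_nonneg, one_le_div hn0]; exact h')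
        (by have : 2 * ((j : ℝ) + 1) / n < 2 := by rw [div_lt_iff₀ hn0]; linarith
            linarith) (by positivity)
        (by rw [e]
            have : 2 * ((j : ℝ) + 1 + 1) / n ≤ 2 := by rw [div_le_iff₀ hn0]; linarith
            linarith)
      rw [hval, hdiv, e] at this
      have h3 : a j ≤ G (j + 1) := by
        simp only [ha]
        split_ifs
        · exact hGm (by linarith)
        · exact le_rfl
      have h4 : a (j + 1) = G (j + 1 + 1) := by
        simp only [ha, h, if_false]; push_cast; rfl
      rw [h4]
      simp only [hG] at h3 ⊢
      linarith
  calc _ ≤ ∑ j ∈ Finset.range (n - 1), (a (j + 1) - a j) := Finset.sum_le_sum hterm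
    _ = a (n - 1) - a 0 := Finset.sum_range_sub a _
    _ = Real.pi := by
      have h1 : ¬ 2 * (n - 1) ≤ n := by omega
      have h2 : ((n - 1 : ℕ) : ℝ) + 1 = n := by exact_mod_cast (by omega : n - 1 + 1 = n)
      simp only [ha, h1, if_false, h2, hG]
      have h3 : 2 * (n : ℝ) / n - 1 = 1 := by field_simp; norm_num
      rw [h3]
      simp

lemma factorial_upper (n : ℕ) (hn : 1 ≤ n) :
    (n.factorial : ℝ) ≤ Real.exp 1 * √n * (n / Real.exp 1) ^ n := by
  obtain ⟨m, rfl⟩ : ∃ m, n = m + 1 := ⟨n - 1, by omega⟩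
  have h := Stirling.stirlingSeq'_antitone (Nat.zero_le m)
  simp only [Function.comp, Nat.succ_eq_add_one, zero_add, Stirling.stirlingSeq_one] at h
  rw [Stirling.stirlingSeq, div_le_iff₀ (by positivity)] at h
  refine h.trans (le_of_eq ?_)
  rw [Real.sqrt_mul (by norm_num)]
  field_simp

lemma term_bound (k m : ℕ) (hk : 1 ≤ k) (hm : 1 ≤ m) :
    ((k + m).choose k : ℝ) * ((k : ℝ) / (k + m)) ^ k * ((m : ℝ) / (k + m)) ^ m ≤
      Real.exp 1 * √(k + m) / (2 * Real.pi) * (1 / √((k : ℝ) * m)) := by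
  have hk0 : (0 : ℝ) < k := by positivity
  have hm0 : (0 : ℝ) < m := by positivity
  have h1 := factorial_upper (k + m) (by omega)
  have h2 := Stirling.le_factorial_stirling k
  have h3 := Stirling.le_factorial_stirling m
  have hc : ((k + m).choose k : ℝ) = (k + m).factorial / (k.factorial * m.factorial) := by
    rw [Nat.cast_choose ℝ (by omega : k ≤ k + m)]; simp
  have hpi := Real.pi_pos
  have hb : ((k + m).choose k : ℝ) ≤ (Real.exp 1 * √((k + m : ℕ) : ℝ) * (((k + m : ℕ) : ℝ) / Real.exp 1) ^ (k + m)) /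
      ((√(2 * Real.pi * k) * (k / Real.exp 1) ^ k) * (√(2 * Real.pi * m) * (m / Real.exp 1) ^ m)) := by
    rw [hc]
    gcongr
  push_cast at hb
  calc _ ≤ (Real.exp 1 * √((k + m : ℝ)) * (((k + m : ℝ)) / Real.exp 1) ^ (k + m)) /
      ((√(2 * Real.pi * k) * (k / Real.exp 1) ^ k) * (√(2 * Real.pi * m) * (m / Real.exp 1) ^ m))
      * ((k : ℝ) / (k + m)) ^ k * ((m : ℝ) / (k + m)) ^ m := by gcongr
    _ = Real.exp 1 * √(k + m) / (√(2 * Real.pi * k) * √(2 * Real.pi * m)) := by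
      rw [pow_add]
      simp only [div_pow]
      field_simp
    _ = _ := by
      have : √(2 * Real.pi * k) * √(2 * Real.pi * m) = 2 * Real.pi * √((k : ℝ) * m) := by
        rw [← Real.sqrt_mul (by positivity)]
        rw [show 2 * Real.pi * k * (2 * Real.pi * m) = (2 * Real.pi) ^ 2 * (k * m) by ring]
        rw [Real.sqrt_mul (by positivity), Real.sqrt_sq (by positivity)]
      rw [this]
      field_simp

lemma xi_bound (n : ℕ) (hn : 8 ≤ n) :
    ∑ k ∈ Finset.range (n + 1), (n.choose k : ℝ) * ((k : ℝ) / n) ^ k * (1 - (k : ℝ) / n) ^ (n - k)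
      ≤ 2 * √n := by
  by_cases h10 : 10 ≤ n
  · have hn0 : (0 : ℝ) < n := by positivity
    rw [Finset.sum_range_succ]
    have hr : n = (n - 1) + 1 := by omega
    have hs : ∑ k ∈ Finset.range n, (n.choose k : ℝ) * ((k : ℝ) / n) ^ k * (1 - (k : ℝ) / n) ^ (n - k)
        = ∑ j ∈ Finset.range (n - 1), (n.choose (j + 1) : ℝ) * (((j + 1 : ℕ) : ℝ) / n) ^ (j + 1) * (1 - ((j + 1 : ℕ) : ℝ) / n) ^ (n - (j + 1)) + 1 := by
      conv_lhs => rw [hr, Finset.sum_range_succ', ← hr]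
      simp
    rw [hs]
    have hb : ∑ j ∈ Finset.range (n - 1), (n.choose (j + 1) : ℝ) * (((j + 1 : ℕ) : ℝ) / n) ^ (j + 1) * (1 - ((j + 1 : ℕ) : ℝ) / n) ^ (n - (j + 1)) ≤
        ∑ j ∈ Finset.range (n - 1), Real.exp 1 * √n / (2 * Real.pi) * (1 / √(((j : ℝ) + 1) * (n - (j + 1)))) := by
      apply Finset.sum_le_sum
      intro j hj
      rw [Finset.mem_range] at hj
      obtain ⟨m, hm⟩ : ∃ m, n = (j + 1) + m := ⟨n - (j + 1), by omega⟩
      have h := term_bound (j + 1) m (by omega) (by omega)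
      have hc : ((j + 1 : ℕ) : ℝ) + m = n := by exact_mod_cast hm.symm
      have e1 : (1 : ℝ) - ((j + 1 : ℕ) : ℝ) / n = m / n := by
        field_simp; linarith
      have e2 : (n : ℝ) - (j + 1) = m := by push_cast at hc; linarith
      have e3 : n - (j + 1) = m := by omega
      rw [hc, ← hm] at h
      rw [e1, e2, e3]
      refine h.trans (le_of_eq ?_)
      push_cast; rfl
    rw [← Finset.mul_sum] at hb
    have h2 : Real.exp 1 * √n / (2 * Real.pi) * ∑ j ∈ Finset.range (n - 1), (1 / √(((j : ℝ) + 1) * (n - (j + 1)))) ≤ Real.exp 1 * √n / (2 * Real.pi) * Real.pi := by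
      have := Real.pi_pos
      gcongr
      exact sum_inv_sqrt n (by omega)
    have h3 : Real.exp 1 * √n / (2 * Real.pi) * Real.pi = Real.exp 1 * √n / 2 := by
      have := Real.pi_pos
      field_simp
    have h4 : (n.choose n : ℝ) * ((n : ℝ) / n) ^ n * (1 - (n : ℝ) / n) ^ (n - n) = 1 := by
      simp [div_self hn0.ne']
    rw [h4]
    have h5 : (3.16 : ℝ) ≤ √n := by
      apply Real.le_sqrt_of_sq_le
      have : (10 : ℝ) ≤ n := by exact_mod_cast h10
      norm_num; linarith
    have h6 := Real.exp_one_lt_d9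
    nlinarith
  · have : n = 8 ∨ n = 9 := by omega
    rcases this with rfl | rfl
    · have h5 : (2.8 : ℝ) ≤ √(8 : ℕ) := by
        apply Real.le_sqrt_of_sq_le
        norm_num
      refine le_trans ?_ (mul_le_mul_of_nonneg_left h5 (by norm_num))
      simp only [Finset.sum_range_succ, Finset.sum_range_zero]
      norm_num [Nat.choose]
    · have h5 : (3 : ℝ) ≤ √(9 : ℕ) := by
        apply Real.le_sqrt_of_sq_le
        norm_num
      refine le_trans ?_ (mul_le_mul_of_nonneg_left h5 (by norm_num))
      simp only [Finset.sum_range_succ, Finset.sum_range_zero]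
      norm_num [Nat.choose]

noncomputable def klR (x p : ℝ) : ℝ := x * Real.log (x / p) + (1 - x) * Real.log ((1 - x) / (1 - p))

lemma mul_log_div' (x p : ℝ) (hp : p ≠ 0) : x * Real.log (x / p) = x * Real.log x - x * Real.log p := by
  by_cases hx : x = 0
  · simp [hx]
  · rw [Real.log_div hx hp]; ring

lemma klR_convex (p : ℝ) (h0 : 0 < p) (h1 : p < 1) :
    ConvexOn ℝ (Set.Icc 0 1) (fun x => klR x p) := by
  have A : ConvexOn ℝ (Set.Icc (0 : ℝ) 1) (fun x => x * Real.log x) :=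
    Real.convexOn_mul_log.subset (fun x hx => hx.1) (convex_Icc 0 1)
  refine ⟨convex_Icc 0 1, ?_⟩
  intro x hx y hy a b ha hb hab
  have hxy := A.2 hx hy ha hb hab
  have hxy' := A.2 (x := 1 - x) (y := 1 - y) ⟨by linarith [hx.2], by linarith [hx.1]⟩
    ⟨by linarith [hy.2], by linarith [hy.1]⟩ ha hb hab
  simp only [smul_eq_mul] at hxy hxy' ⊢
  have e : a * (1 - x) + b * (1 - y) = 1 - (a * x + b * y) := by linear_combination hab
  rw [e] at hxy'
  unfold klR
  simp only [mul_log_div' _ _ h0.ne', mul_log_div' _ _ (sub_pos.2 h1).ne']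
  have hb' : b = 1 - a := by linarith
  subst hb'
  linarith

lemma exp_klR_convex (n : ℕ) (p : ℝ) (h0 : 0 < p) (h1 : p < 1) :
    ConvexOn ℝ (Set.Icc 0 1) (fun x => Real.exp (n * klR x p)) := by
  have hc : ConvexOn ℝ (Set.Icc 0 1) (fun x => (n : ℝ) * klR x p) := by
    simpa using (klR_convex p h0 h1).smul (c := (n : ℝ)) (by positivity)
  refine ⟨convex_Icc 0 1, ?_⟩
  intro x hx y hy a b ha hb hab
  exact (Real.exp_le_exp.2 (hc.2 hx hy ha hb hab)).trans
    (convexOn_exp.2 (Set.mem_univ _) (Set.mem_univ _) ha hb hab)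

lemma sum_w {n : ℕ} (f g : Fin n → ℝ) :
    ∑ t : Finset (Fin n), ∏ i, (if i ∈ t then f i else g i) = ∏ i, (f i + g i) := by
  rw [Fintype.prod_add]
  refine Finset.sum_congr rfl fun t _ => ?_
  rw [Finset.prod_ite]
  congr 2
  · ext; simp
  · ext; simp

lemma mean_w {n : ℕ} (x : Fin n → ℝ) :
    ∑ t : Finset (Fin n), (∏ i, (if i ∈ t then x i else 1 - x i)) * (t.card : ℝ) = ∑ i, x i := by
  have h : ∀ t : Finset (Fin n), (∏ i, (if i ∈ t then x i else 1 - x i)) * (t.card : ℝ)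
      = ∑ i, ∏ j, (if j ∈ t then x j else (if j = i then 0 else 1 - x j)) := by
    intro t
    have : (t.card : ℝ) = ∑ i, if i ∈ t then (1 : ℝ) else 0 := by simp
    rw [this, Finset.mul_sum]
    refine Finset.sum_congr rfl fun i _ => ?_
    by_cases hi : i ∈ t
    · simp only [hi, if_true, mul_one]
      refine Finset.prod_congr rfl fun j _ => ?_
      by_cases hj : j ∈ t
      · simp [hj]
      · have : j ≠ i := fun h => hj (h ▸ hi)
        simp [hj, this]
    · simp only [hi, if_false, mul_zero]
      symm
      apply Finset.prod_eq_zero (Finset.mem_univ i)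
      simp [hi]
  simp only [h]
  rw [Finset.sum_comm]
  refine Finset.sum_congr rfl fun i _ => ?_
  rw [sum_w]
  rw [Finset.prod_eq_single i]
  · simp
  · intro j _ hj; simp [hj]
  · simp

lemma pointwise_w {n : ℕ} (hn : 0 < n) (φ : ℝ → ℝ) (hφ : ConvexOn ℝ (Set.Icc 0 1) φ)
    (x : Fin n → ℝ) (hx0 : ∀ i, 0 ≤ x i) (hx1 : ∀ i, x i ≤ 1) :
    φ (1 / (n : ℝ) * ∑ i, x i) ≤
      ∑ t : Finset (Fin n), (∏ i, (if i ∈ t then x i else 1 - x i)) * φ ((t.card : ℝ) / n) := by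
  have hn0 : (0 : ℝ) < n := by exact_mod_cast hn
  have := hφ.map_sum_le (t := (Finset.univ : Finset (Finset (Fin n))))
    (w := fun t => ∏ i, (if i ∈ t then x i else 1 - x i)) (p := fun t => (t.card : ℝ) / n)
    (fun t _ => Finset.prod_nonneg fun i _ => by
      split_ifs
      · exact hx0 i
      · linarith [hx1 i])
    (by rw [sum_w]; simp)
    (fun t _ => ⟨by positivity, by
      rw [div_le_one hn0]
      have := Finset.card_le_univ t
      rw [Fintype.card_fin] at this
      exact_mod_cast this⟩)
  simp only [smul_eq_mul] at this
  have e : 1 / (n : ℝ) * ∑ i, x i = ∑ t : Finset (Fin n),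
      (∏ i, (if i ∈ t then x i else 1 - x i)) * ((t.card : ℝ) / n) := by
    rw [← mean_w x, Finset.mul_sum]
    refine Finset.sum_congr rfl fun t _ => ?_
    ring
  rw [e]
  exact this

lemma exp_nat_log (k : ℕ) (y : ℝ) (h : k = 0 ∨ 0 < y) : Real.exp (k * Real.log y) = y ^ k := by
  rcases h with rfl | h
  · simp
  · rw [Real.exp_nat_mul, Real.exp_log h]

lemma binom_term (n k : ℕ) (hn : 0 < n) (hk : k ≤ n) (p : ℝ) (h0 : 0 < p) (h1 : p < 1) :
    p ^ k * (1 - p) ^ (n - k) * Real.exp (n * klR ((k : ℝ) / n) p) =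
      ((k : ℝ) / n) ^ k * (1 - (k : ℝ) / n) ^ (n - k) := by
  have hn0 : (0 : ℝ) < n := by exact_mod_cast hn
  have hp : 0 < 1 - p := by linarith
  have e : (n : ℝ) * klR ((k : ℝ) / n) p = (k : ℝ) * Real.log ((k : ℝ) / n / p)
      + ((n - k : ℕ) : ℝ) * Real.log ((1 - (k : ℝ) / n) / (1 - p)) := by
    unfold klR
    rw [Nat.cast_sub hk]
    field_simp
  rw [e, Real.exp_add, exp_nat_log, exp_nat_log, div_pow (k / n : ℝ), div_pow (1 - (k / n : ℝ))]
  · field_simp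
  · rcases Nat.lt_or_ge k n with h | h
    · right
      have : (k : ℝ) / n < 1 := by rw [div_lt_one hn0]; exact_mod_cast h
      exact div_pos (by linarith) hp
    · left; omega
  · rcases Nat.eq_zero_or_pos k with h | h
    · left; exact h
    · right; positivity

noncomputable def EE (n : ℕ) (x p : ℝ) : ENNReal :=
  if 0 < p ∧ p < 1 then ENNReal.ofReal (Real.exp (n * klR x p)) else if x = p then 1 else ⊤

lemma measurable_EE (n : ℕ) : Measurable (fun q : ℝ × ℝ => EE n q.1 q.2) := by
  unfold EE klR
  refine Measurable.ite ?_ (by fun_prop) (Measurable.ite ?_ (by fun_prop) (by fun_prop))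
  · exact (measurableSet_lt measurable_const measurable_snd).inter
      (measurableSet_lt measurable_snd measurable_const)
  · exact measurableSet_eq_fun measurable_fst measurable_snd

lemma EE_integral {Z : Type*} [MeasurableSpace Z] (μ : Measure Z) [IsProbabilityMeasure μ]
    (n : ℕ) (hn : 8 ≤ n) (f : Z → ℝ) (hf : Measurable f) (hf0 : ∀ z, 0 ≤ f z) (hf1 : ∀ z, f z ≤ 1) :
    ∫⁻ S, EE n (1 / (n : ℝ) * ∑ i, f (S i)) (∫ z, f z ∂μ) ∂(Measure.pi fun _ : Fin n => μ)
      ≤ ENNReal.ofReal (2 * √n) := by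
  have hn0 : (0 : ℝ) < n := by positivity
  have hint : Integrable f μ := Integrable.of_bound hf.aestronglyMeasurable 1
    (ae_of_all _ fun z => by rw [Real.norm_eq_abs, abs_of_nonneg (hf0 z)]; exact hf1 z)
  have hp0 : 0 ≤ ∫ z, f z ∂μ := integral_nonneg hf0
  have hp1 : ∫ z, f z ∂μ ≤ 1 := by
    calc ∫ z, f z ∂μ ≤ ∫ z, (1 : ℝ) ∂μ := integral_mono hint (integrable_const _) hf1
      _ = 1 := by simp
  set p := ∫ z, f z ∂μ with hp
  -- a degenerate case
  have deg : ∀ c : ℝ, f =ᵐ[μ] (fun _ => c) → p = c → ¬ (0 < p ∧ p < 1) →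
      ∫⁻ S, EE n (1 / (n : ℝ) * ∑ i, f (S i)) p ∂(Measure.pi fun _ : Fin n => μ)
      ≤ ENNReal.ofReal (2 * √n) := by
    intro c hc hpc hnd
    have h1 : ∀ᵐ S ∂(Measure.pi fun _ : Fin n => μ), ∀ i, f (S i) = c := by
      rw [ae_all_iff]
      intro i
      exact (measurePreserving_eval (fun _ : Fin n => μ) i).quasiMeasurePreserving.ae hc
    have h2 : ∀ᵐ S ∂(Measure.pi fun _ : Fin n => μ),
        EE n (1 / (n : ℝ) * ∑ i, f (S i)) p = 1 := by
      filter_upwards [h1] with S hS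
      have : 1 / (n : ℝ) * ∑ i, f (S i) = p := by
        simp only [hS, hpc]
        simp
        field_simp
      rw [this]
      simp [EE, hnd]
    rw [lintegral_congr_ae h2]
    simp only [lintegral_const, measure_univ, mul_one]
    rw [← ENNReal.ofReal_one]
    apply ENNReal.ofReal_le_ofReal
    have : 1 ≤ √(n : ℝ) := by
      rw [Real.one_le_sqrt]
      exact_mod_cast (by omega : 1 ≤ n)
    linarith
  by_cases hc : 0 < p ∧ p < 1
  swap
  · rcases hp0.eq_or_lt with h | h
    · refine deg 0 ?_ h.symm hc
      exact (integral_eq_zero_iff_of_nonneg hf0 hint).1 h.symm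
    · have h1 : p = 1 := by
        by_contra h'
        exact hc ⟨h, lt_of_le_of_ne hp1 h'⟩
      refine deg 1 ?_ h1 hc
      have : ∫ z, (1 - f z) ∂μ = 0 := by
        rw [integral_sub (integrable_const _) hint]; simp [← hp, h1]
      have := (integral_eq_zero_iff_of_nonneg (fun z => sub_nonneg.2 (hf1 z))
        ((integrable_const _).sub hint)).1 this
      filter_upwards [this] with z hz
      simp at hz
      linarith
  · set φ : ℝ → ℝ := fun x => Real.exp (n * klR x p) with hφ
    have hI : ∀ t : Finset (Fin n), Integrable (fun S : Fin n → Z =>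
        ∏ i, (if i ∈ t then f (S i) else 1 - f (S i))) (Measure.pi fun _ : Fin n => μ) := by
      intro t
      have := Integrable.fintype_prod (μ := fun _ : Fin n => μ)
        (f := fun i z => if i ∈ t then f z else 1 - f z) (fun i => by
          by_cases h : i ∈ t
          · simpa [h] using hint
          · simp only [h, if_false]
            exact (integrable_const (1 : ℝ)).sub hint)
      exact this
    have hV : ∀ t : Finset (Fin n), ∫ S : Fin n → Z,
        ∏ i, (if i ∈ t then f (S i) else 1 - f (S i)) ∂(Measure.pi fun _ : Fin n => μ)
        = p ^ t.card * (1 - p) ^ (n - t.card) := by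
      intro t
      rw [integral_fintype_prod_eq_prod (μ := fun _ : Fin n => μ)
        (fun i z => if i ∈ t then f z else 1 - f z)]
      have : ∀ i, ∫ z, (if i ∈ t then f z else 1 - f z) ∂μ = if i ∈ t then p else 1 - p := by
        intro i
        split_ifs
        · rfl
        · rw [integral_sub (integrable_const _) hint]; simp [← hp]
      simp only [this]
      rw [Finset.prod_ite]
      simp only [Finset.prod_const]
      congr 2
      · congr 1; ext; simp
      · have hcc := Finset.card_compl t
        rw [Fintype.card_fin] at hcc
        rw [← hcc]
        congr 1; ext; simp
    have hI2 : Integrable (fun S : Fin n → Z => ∑ t : Finset (Fin n),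
        (∏ i, (if i ∈ t then f (S i) else 1 - f (S i))) * φ ((t.card : ℝ) / n))
        (Measure.pi fun _ : Fin n => μ) :=
      integrable_finsetSum _ fun t _ => (hI t).mul_const _
    calc ∫⁻ S, EE n (1 / (n : ℝ) * ∑ i, f (S i)) p ∂(Measure.pi fun _ : Fin n => μ)
        ≤ ∫⁻ S : Fin n → Z, ENNReal.ofReal (∑ t : Finset (Fin n),
        (∏ i, (if i ∈ t then f (S i) else 1 - f (S i))) * φ ((t.card : ℝ) / n))
          ∂(Measure.pi fun _ : Fin n => μ) := by
          apply lintegral_mono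
          intro S
          simp only [EE, hc, and_self, if_true]
          apply ENNReal.ofReal_le_ofReal
          exact pointwise_w (by omega) φ (exp_klR_convex n p hc.1 hc.2) (fun i => f (S i))
            (fun i => hf0 _) (fun i => hf1 _)
      _ = ENNReal.ofReal (∫ S : Fin n → Z, ∑ t : Finset (Fin n),
        (∏ i, (if i ∈ t then f (S i) else 1 - f (S i))) * φ ((t.card : ℝ) / n)
          ∂(Measure.pi fun _ : Fin n => μ)) := by
          rw [ofReal_integral_eq_lintegral_ofReal hI2]
          refine ae_of_all _ fun S => Finset.sum_nonneg fun t _ => mul_nonneg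
            (Finset.prod_nonneg fun i _ => ?_) (Real.exp_pos _).le
          split_ifs
          · exact hf0 _
          · linarith [hf1 (S i)]
      _ ≤ _ := by
          apply ENNReal.ofReal_le_ofReal
          rw [integral_finsetSum _ fun t _ => (hI t).mul_const _]
          simp only [integral_mul_const, hV]
          have := Finset.sum_powerset_apply_card (x := (Finset.univ : Finset (Fin n)))
            (fun k => p ^ k * (1 - p) ^ (n - k) * φ ((k : ℝ) / n))
          rw [Finset.powerset_univ, Finset.card_univ, Fintype.card_fin] at this
          rw [this]
          refine le_trans (le_of_eq ?_) (xi_bound n hn)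
          refine Finset.sum_congr rfl fun k hk => ?_
          rw [Finset.mem_range] at hk
          rw [nsmul_eq_mul, mul_assoc (n.choose k : ℝ),
            ← binom_term n k (by omega) (by omega) p hc.1 hc.2]

lemma xlog_lower (x p t : ℝ) (hx : 0 ≤ x) (hp : 0 < p) (ht : 0 < t) :
    x * Real.log t + x - p * t ≤ x * Real.log (x / p) := by
  rcases hx.eq_or_lt with rfl | hx
  · simp; positivity
  · have h := Real.log_le_sub_one_of_pos (show 0 < p * t / x by positivity)
    rw [Real.log_div (by positivity) hx.ne', Real.log_mul hp.ne' ht.ne'] at h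
    have h2 := mul_le_mul_of_nonneg_left h hx.le
    have e : x * (p * t / x - 1) = p * t - x := by field_simp
    rw [e] at h2
    rw [Real.log_div hx.ne' hp.ne']
    linarith

lemma EE_lower (n : ℕ) (x p t s : ℝ) (hx0 : 0 ≤ x) (hx1 : x ≤ 1) (hp0 : 0 ≤ p) (hp1 : p ≤ 1)
    (ht : 0 < t) (hs : 0 < s) :
    ENNReal.ofReal (Real.exp (n * (x * Real.log t + (1 - x) * Real.log s + 1 - p * t - (1 - p) * s)))
      ≤ EE n x p := by
  unfold EE
  split_ifs with h1 h2
  · apply ENNReal.ofReal_le_ofReal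
    rw [Real.exp_le_exp]
    gcongr
    have a := xlog_lower x p t hx0 h1.1 ht
    have b := xlog_lower (1 - x) (1 - p) s (by linarith) (by linarith [h1.2]) hs
    unfold klR
    linarith
  · rw [← ENNReal.ofReal_one]
    apply ENNReal.ofReal_le_ofReal
    rw [Real.exp_le_one_iff]
    apply mul_nonpos_of_nonneg_of_nonpos (by positivity)
    have h3 : p = 0 ∨ p = 1 := by
      by_contra hc
      push Not at hc
      exact h1 ⟨lt_of_le_of_ne hp0 (Ne.symm hc.1), lt_of_le_of_ne hp1 hc.2⟩
    have a := Real.log_le_sub_one_of_pos ht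
    have b := Real.log_le_sub_one_of_pos hs
    subst h2
    rcases h3 with rfl | rfl
    · linarith
    · linarith
  · exact le_top

lemma log_unbounded (P B : ℝ) (hP : 0 ≤ P) (h : ∀ t : ℝ, 0 < t → P * Real.log t ≤ B) : P = 0 := by
  by_contra hne
  have hP' : 0 < P := lt_of_le_of_ne hP (Ne.symm hne)
  have := h (Real.exp ((B + 1) / P)) (Real.exp_pos _)
  rw [Real.log_exp, mul_div_cancel₀ _ hP'.ne'] at this
  linarith

lemma klBerE_le (P q B : ℝ) (hP0 : 0 ≤ P) (hP1 : P ≤ 1) (hq0 : 0 ≤ q) (hq1 : q ≤ 1)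
    (h : ∀ t s : ℝ, 0 < t → 0 < s →
      P * Real.log t + (1 - P) * Real.log s + 1 - q * t - (1 - q) * s ≤ B) :
    klBerE P q ≤ (B : EReal) := by
  have hB : 0 ≤ B := by
    have := h 1 1 one_pos one_pos
    simp at this
    linarith
  rcases hq0.eq_or_lt with hq | hq
  · subst hq
    have : P = 0 := log_unbounded P B hP0 fun t ht => by
      have := h t 1 ht one_pos
      simp at this
      linarith
    subst this
    simp only [klBerE]
    simpa using hB
  rcases hq1.eq_or_lt with hq' | hq'
  · subst hq'
    have : 1 - P = 0 := log_unbounded (1 - P) B (by linarith) fun t ht => by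
      have := h 1 t one_pos ht
      simp at this
      linarith
    have : P = 1 := by linarith
    subst this
    simp only [klBerE]
    simpa using hB
  have hq1' : 0 < 1 - q := by linarith
  have hk : klBerE P q = ((klR P q : ℝ) : EReal) := by
    unfold klBerE klR
    rw [EReal.coe_add]
    congr 1
    · split_ifs with h1
      · simp [h1]
      · exact absurd ‹q = 0› hq.ne'
      · rfl
    · split_ifs with h1
      · simp [h1]
      · exact absurd ‹q = 1› hq'.ne
      · rfl
  rw [hk, EReal.coe_le_coe_iff]
  unfold klR
  rcases hP0.eq_or_lt with hP | hP
  · subst hP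
    apply le_of_forall_pos_le_add
    intro ε hε
    have := h (ε / q) (1 / (1 - q)) (by positivity) (by positivity)
    rw [mul_div_cancel₀ _ hq.ne', mul_div_cancel₀ _ hq1'.ne'] at this
    simp at this ⊢
    linarith
  rcases hP1.eq_or_lt with hP' | hP'
  · subst hP'
    apply le_of_forall_pos_le_add
    intro ε hε
    have := h (1 / q) (ε / (1 - q)) (by positivity) (by positivity)
    rw [mul_div_cancel₀ _ hq.ne', mul_div_cancel₀ _ hq1'.ne'] at this
    simp at this ⊢
    linarith
  have hP1' : 0 < 1 - P := by linarith
  have := h (P / q) ((1 - P) / (1 - q)) (by positivity) (by positivity)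
  rw [mul_div_cancel₀ _ hq.ne', mul_div_cancel₀ _ hq1'.ne'] at this
  linarith

lemma dv_bound {H : Type*} [MeasurableSpace H] (Q Q₀ : Measure H) [IsProbabilityMeasure Q]
    [IsProbabilityMeasure Q₀] (hac : Q ≪ Q₀) (hint : Integrable (llr Q Q₀) Q)
    (g : H → ℝ) (hg : Measurable g) (hgQ : Integrable g Q) (C : ℝ) (hC : 0 < C)
    (hle : ∫⁻ h, ENNReal.ofReal (Real.exp (g h)) ∂Q₀ ≤ ENNReal.ofReal C) :
    ∫ h, g h ∂Q ≤ ∫ h, llr Q Q₀ h ∂Q + Real.log C := by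
  have hexp : Integrable (fun h => Real.exp (g h)) Q₀ := by
    refine ⟨by fun_prop, ?_⟩
    rw [hasFiniteIntegral_iff_ofReal (ae_of_all _ fun h => (Real.exp_pos _).le)]
    exact hle.trans_lt ENNReal.ofReal_lt_top
  have hI : ∫ h, Real.exp (g h) ∂Q₀ ≤ C := by
    rw [← ofReal_integral_eq_lintegral_ofReal hexp (ae_of_all _ fun h => (Real.exp_pos _).le)] at hle
    exact (ENNReal.ofReal_le_ofReal_iff hC.le).1 hle
  have hpos : 0 < ∫ h, Real.exp (g h) ∂Q₀ := integral_exp_pos hexp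
  have : IsProbabilityMeasure (Q₀.tilted g) := isProbabilityMeasure_tilted hexp
  have h1 := InformationTheory.integral_llr_add_sub_measure_univ_nonneg (μ := Q) (ν := Q₀.tilted g)
    (hac.trans (absolutelyContinuous_tilted hexp))
    (integrable_llr_tilted_right hac hgQ hint hexp)
  rw [integral_llr_tilted_right hac hgQ hexp hint] at h1
  simp at h1
  have := Real.log_le_log hpos hI
  linarith

lemma core {H : Type*} [MeasurableSpace H] (Q Q₀ : Measure H) [IsProbabilityMeasure Q]
    [IsProbabilityMeasure Q₀] (n : ℕ) (hn : 0 < n) (x p : H → ℝ) (hx : Measurable x)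
    (hp : Measurable p) (hx0 : ∀ h, 0 ≤ x h) (hx1 : ∀ h, x h ≤ 1) (hp0 : ∀ h, 0 ≤ p h)
    (hp1 : ∀ h, p h ≤ 1) (C : ℝ) (hC : 0 < C)
    (hle : ∫⁻ h, EE n (x h) (p h) ∂Q₀ ≤ ENNReal.ofReal C) :
    klBerE (∫ h, x h ∂Q) (∫ h, p h ∂Q) ≤
      (measKL Q Q₀ + ((Real.log C : ℝ) : EReal)) / (n : EReal) := by
  have hn0 : (0 : ℝ) < n := by exact_mod_cast hn
  unfold measKL
  split_ifs with hK
  swap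
  · rw [EReal.top_add_coe, EReal.top_div_of_pos_ne_top (by exact_mod_cast hn)
      (EReal.natCast_ne_top n)]
    exact le_top
  obtain ⟨hac, hint⟩ := hK
  have hb : ∀ f : H → ℝ, Measurable f → (∀ h, 0 ≤ f h) → (∀ h, f h ≤ 1) →
      Integrable f Q ∧ 0 ≤ ∫ h, f h ∂Q ∧ ∫ h, f h ∂Q ≤ 1 := by
    intro f hf hf0 hf1
    have hint : Integrable f Q := Integrable.of_bound hf.aestronglyMeasurable 1
      (ae_of_all _ fun z => by rw [Real.norm_eq_abs, abs_of_nonneg (hf0 z)]; exact hf1 z)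
    refine ⟨hint, integral_nonneg hf0, ?_⟩
    calc ∫ z, f z ∂Q ≤ ∫ z, (1 : ℝ) ∂Q := integral_mono hint (integrable_const _) hf1
      _ = 1 := by simp
  obtain ⟨hxi, hX0, hX1⟩ := hb x hx hx0 hx1
  obtain ⟨hpi, hP0, hP1⟩ := hb p hp hp0 hp1
  have e : (((∫ h, Real.log (Q.rnDeriv Q₀ h).toReal ∂Q : ℝ) : EReal) + ((Real.log C : ℝ) : EReal)) / (n : EReal)
      = (((∫ h, Real.log (Q.rnDeriv Q₀ h).toReal ∂Q + Real.log C) / n : ℝ) : EReal) := by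
    rw [EReal.coe_div, EReal.coe_add]; rfl
  rw [e]
  apply klBerE_le _ _ _ hX0 hX1 hP0 hP1
  intro t s ht hs
  rw [le_div_iff₀ hn0]
  have key := dv_bound Q Q₀ hac hint
    (fun h => n * (x h * Real.log t + (1 - x h) * Real.log s + 1 - p h * t - (1 - p h) * s))
    (by fun_prop) (by fun_prop) C hC
    ((lintegral_mono fun h => EE_lower n (x h) (p h) t s (hx0 h) (hx1 h) (hp0 h) (hp1 h) ht hs).trans hle)
  refine le_trans (le_of_eq ?_) key
  have e2 : ∀ h, n * (x h * Real.log t + (1 - x h) * Real.log s + 1 - p h * t - (1 - p h) * s)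
      = (n * (Real.log t - Real.log s)) * x h + (n * (s - t)) * p h + n * (Real.log s + 1 - s) := by
    intro h; ring
  simp only [e2]
  rw [integral_add (by fun_prop) (by fun_prop), integral_add (by fun_prop) (by fun_prop),
    integral_const_mul, integral_const_mul]
  simp
  ring

/-- PAC-Bayes-kl bound (Maurer). With probability at least `1 − δ` over an i.i.d.
sample `S` of size `n ≥ 8` from `μ`, every data-dependent posterior `Q S` satisfies
`kl(L̂_S(Q S) ‖ L(Q S)) ≤ (KL(Q S‖Q₀) + log(2√n/δ)) / n`. -/
theorem pac_bayes_kl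
    {Z H : Type*} [MeasurableSpace Z] [MeasurableSpace H]
    (μ : Measure Z) [IsProbabilityMeasure μ]
    (n : ℕ) (hn : 8 ≤ n) (δ : ℝ) (hδ0 : 0 < δ) (hδ1 : δ < 1)
    (l : H → Z → ℝ) (hl : Measurable (Function.uncurry l))
    (hl0 : ∀ h z, 0 ≤ l h z) (hl1 : ∀ h z, l h z ≤ 1)
    (Q₀ : Measure H) [IsProbabilityMeasure Q₀]
    (Q : Kernel (Fin n → Z) H) [IsMarkovKernel Q] :
    1 - ENNReal.ofReal δ ≤
      (Measure.pi fun _ : Fin n => μ)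
        {S : Fin n → Z |
          klBerE (∫ h, (1 / (n : ℝ)) * ∑ i, l h (S i) ∂(Q S))
              (∫ h, ∫ z, l h z ∂μ ∂(Q S)) ≤
            (measKL (Q S) Q₀ +
              ((Real.log (2 * Real.sqrt n / δ) : ℝ) : EReal)) / (n : EReal)} := by
  have hn0 : (0 : ℝ) < n := by positivity
  set ν := Measure.pi fun _ : Fin n => μ with hν
  set p : H → ℝ := fun h => ∫ z, l h z ∂μ with hp
  set x : (Fin n → Z) → H → ℝ := fun S h => (1 / (n : ℝ)) * ∑ i, l h (S i) with hx
  have hlh : ∀ h, Measurable (l h) := fun h => hl.comp measurable_prodMk_left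
  have hpm : Measurable p := by
    exact (hl.stronglyMeasurable.integral_prod_right (ν := μ)).measurable
  have hxm : Measurable (fun w : (Fin n → Z) × H => x w.1 w.2) := by
    simp only [hx]
    refine Measurable.const_mul (Finset.measurable_sum _ fun i _ => ?_) _
    exact hl.comp (measurable_snd.prodMk ((measurable_pi_apply i).comp measurable_fst))
  have hEm : Measurable (fun w : (Fin n → Z) × H => EE n (x w.1 w.2) (p w.2)) :=
    (measurable_EE n).comp (hxm.prodMk (hpm.comp measurable_snd))
  have hFm : Measurable (fun S => ∫⁻ h, EE n (x S h) (p h) ∂Q₀) := hEm.lintegral_prod_right'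
  have hF : ∫⁻ S, ∫⁻ h, EE n (x S h) (p h) ∂Q₀ ∂ν ≤ ENNReal.ofReal (2 * √n) := by
    rw [lintegral_lintegral_swap hEm.aemeasurable]
    calc ∫⁻ h, ∫⁻ S, EE n (x S h) (p h) ∂ν ∂Q₀ ≤ ∫⁻ h, ENNReal.ofReal (2 * √n) ∂Q₀ :=
          lintegral_mono fun h => EE_integral μ n hn (l h) (hlh h) (hl0 h) (hl1 h)
      _ = _ := by simp
  set C : ℝ := 2 * √n / δ with hC
  have hC0 : 0 < C := by positivity
  have hmk := mul_meas_ge_le_lintegral (μ := ν) hFm (ENNReal.ofReal C)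
  have hbad : ν {S | ENNReal.ofReal C ≤ ∫⁻ h, EE n (x S h) (p h) ∂Q₀} ≤ ENNReal.ofReal δ := by
    have h1 : ENNReal.ofReal C * ν {S | ENNReal.ofReal C ≤ ∫⁻ h, EE n (x S h) (p h) ∂Q₀} ≤
        ENNReal.ofReal C * ENNReal.ofReal δ := by
      refine (hmk.trans hF).trans (le_of_eq ?_)
      rw [← ENNReal.ofReal_mul hC0.le, hC, div_mul_cancel₀ _ hδ0.ne']
    exact (ENNReal.mul_le_mul_iff_right (ENNReal.ofReal_pos.2 hC0).ne' ENNReal.ofReal_ne_top).1 h1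
  have hBm : MeasurableSet {S | ENNReal.ofReal C ≤ ∫⁻ h, EE n (x S h) (p h) ∂Q₀} :=
    measurableSet_le measurable_const hFm
  calc 1 - ENNReal.ofReal δ
      ≤ 1 - ν {S | ENNReal.ofReal C ≤ ∫⁻ h, EE n (x S h) (p h) ∂Q₀} := tsub_le_tsub_left hbad 1
    _ = ν {S | ENNReal.ofReal C ≤ ∫⁻ h, EE n (x S h) (p h) ∂Q₀}ᶜ := (prob_compl_eq_one_sub hBm).symm
    _ ≤ _ := by
      apply measure_mono
      intro S hS
      simp only [Set.mem_compl_iff, Set.mem_setOf_eq, not_le] at hS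
      refine core (Q S) Q₀ n (by omega) (x S) p (hxm.comp measurable_prodMk_left) hpm
        ?_ ?_ ?_ ?_ C hC0 hS.le
      · intro h
        exact mul_nonneg (by positivity) (Finset.sum_nonneg fun i _ => hl0 _ _)
      · intro h
        have : ∑ i, l h (S i) ≤ n := by
          calc ∑ i, l h (S i) ≤ ∑ i : Fin n, (1 : ℝ) := Finset.sum_le_sum fun i _ => hl1 _ _
            _ = n := by simp
        simp only [hx]
        rw [one_div, inv_mul_le_iff₀ hn0]
        linarith
      · intro h
        exact integral_nonneg (hl0 h)
      · intro h
        have hint : Integrable (l h) μ := Integrable.of_bound (hlh h).aestronglyMeasurable 1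
          (ae_of_all _ fun z => by
            rw [Real.norm_eq_abs, abs_of_nonneg (hl0 h z)]; exact hl1 h z)
        calc ∫ z, l h z ∂μ ≤ ∫ z, (1 : ℝ) ∂μ := integral_mono hint (integrable_const _) (hl1 h)
          _ = 1 := by simp
end
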